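/- Let w > 0 and let k ≥ 2 be an integer such that r_{k−1} ≥ w², |θ̃_{k−1}| ≤ 1, and |y_{k−1}| ≤ w/(2√(k−1)), and suppose w_t = −θ̃_{t−1}·y_{t−1} + S(y_{t−1})·w/(2√t) for all t ≥ k. Then for every integer t ≥ k+1, |θ̃_t·y_t| + |y_{t+1}| ≤ |θ̃_{t−1}·y_{t−1}| + |y_t|; consequently |w_t| = |y_t − θ̃_{t−1}y_{t−1}| ≤ |θ̃_k·y_k| + |y_{k+1}| for all t ≥ k+1. -/

import Mathlib

open Filter Finset

/-- The sign function: `-1` if `x < 0`, `1` if `x ≥ 0`. -/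
noncomputable def S (x : ℝ) : ℝ := if x < 0 then -1 else 1

lemma abs_S (x : ℝ) : |S x| = 1 := by
  unfold S
  split_ifs <;> simp

/-- For `n ≥ 2`, the decrement of `1 / √x` from `n + 1` to `n + 2` dominates
`1 / (4 (n + 1) √n)`. -/
lemma inv_four_mul_sqrt_le_inv_sqrt_sub {n : ℕ} (hn : 2 ≤ n) :
    1 / (4 * √(n : ℝ) * (√((n : ℝ) + 1) * √((n : ℝ) + 1))) ≤
      1 / √((n : ℝ) + 1) - 1 / √((n : ℝ) + 2) := by
  have hn' : (2 : ℝ) ≤ n := by exact_mod_cast hn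
  have hA : 0 < √(n : ℝ) := Real.sqrt_pos.2 (by linarith)
  have hB : 0 < √((n : ℝ) + 1) := Real.sqrt_pos.2 (by linarith)
  have hC : 0 < √((n : ℝ) + 2) := Real.sqrt_pos.2 (by linarith)
  have hBC : √((n : ℝ) + 1) ≤ √((n : ℝ) + 2) := Real.sqrt_le_sqrt (by linarith)
  have hA2 : √(n : ℝ) ^ 2 = n := Real.sq_sqrt (by linarith)
  have hB2 : √((n : ℝ) + 1) ^ 2 = n + 1 := Real.sq_sqrt (by linarith)
  have hC2 : √((n : ℝ) + 2) ^ 2 = n + 2 := Real.sq_sqrt (by linarith)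
  generalize √(n : ℝ) = A at *
  generalize √((n : ℝ) + 1) = B at *
  generalize √((n : ℝ) + 2) = C at *
  have hAB : C ^ 2 ≤ 2 * (A * B) := by
    refine (pow_le_pow_iff_left₀ (by positivity) (by positivity) two_ne_zero).1 ?_
    have h : (2 * (A * B)) ^ 2 = 4 * (A ^ 2 * B ^ 2) := by ring
    rw [h, hA2, hB2, hC2]
    nlinarith
  have hsum : C * (B + C) ≤ 4 * (A * B) := by nlinarith
  have hdiff : (C - B) * (B + C) = 1 := by nlinarith
  have hrw : 1 / B - 1 / C = (C - B) / (B * C) := by field_simp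
  rw [hrw, div_le_div_iff₀ (by positivity) (by positivity)]
  have hCB : 0 ≤ C - B := sub_nonneg.2 hBC
  have h : C ≤ (C - B) * (4 * (A * B)) := by
    calc C = (C - B) * (C * (B + C)) := by linear_combination (-C) * hdiff
      _ ≤ _ := mul_le_mul_of_nonneg_left hsum hCB
  nlinarith [mul_le_mul_of_nonneg_left h hB.le]

/-- with the constructed noise, the quantity `|θ̃ t · y t| + |y (t+1)|`
is non-increasing for `t ≥ k+1`; consequently
`|w_t| = |y_t - θ̃_{t-1} y_{t-1}| ≤ |θ̃_k y_k| + |y_{k+1}|` for all `t ≥ k+1`. -/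
theorem lyapunov_decrease
    (y θ r W : ℕ → ℝ) (hr0 : 0 < r 0)
    (hy : ∀ t : ℕ, y (t + 1) = θ t * y t + W (t + 1))
    (hθ : ∀ t : ℕ, θ (t + 1) = θ t - y t * y (t + 1) / r t)
    (hr : ∀ t : ℕ, r (t + 1) = r t + (y (t + 1)) ^ 2)
    (w : ℝ) (hw : 0 < w) (k : ℕ) (hk : 2 ≤ k)
    (hrk : w ^ 2 ≤ r (k - 1))
    (hθk : |θ (k - 1)| ≤ 1)
    (hyk : |y (k - 1)| ≤ w / (2 * Real.sqrt (k - 1 : ℕ)))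
    (hW : ∀ t : ℕ, k ≤ t →
      W t = -θ (t - 1) * y (t - 1) + S (y (t - 1)) * w / (2 * Real.sqrt t)) :
    (∀ t : ℕ, k + 1 ≤ t →
      |θ t * y t| + |y (t + 1)| ≤ |θ (t - 1) * y (t - 1)| + |y t|) ∧
    (∀ t : ℕ, k + 1 ≤ t →
      |W t| = |y t - θ (t - 1) * y (t - 1)| ∧
      |W t| ≤ |θ k * y k| + |y (k + 1)|) := by
  have hyabs : ∀ t, k ≤ t → |y t| = w / (2 * √(t : ℝ)) := by
    intro t ht
    obtain ⟨m, rfl⟩ : ∃ m, t = m + 1 := ⟨t - 1, by omega⟩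
    have h : y (m + 1) = S (y m) * w / (2 * √((m + 1 : ℕ) : ℝ)) := by
      rw [hy, hW _ ht, Nat.add_sub_cancel]
      ring
    rw [h, abs_div, abs_mul, abs_S, abs_of_pos hw, one_mul,
      abs_of_nonneg (a := 2 * √((m + 1 : ℕ) : ℝ)) (by positivity)]
  have hrw : ∀ t, k - 1 ≤ t → w ^ 2 ≤ r t := by
    intro t ht
    induction t, ht using Nat.le_induction with
    | base => exact hrk
    | succ n _ ih => rw [hr]; nlinarith [sq_nonneg (y (n + 1))]
  have hdec : ∀ t : ℕ, k + 1 ≤ t →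
      |θ t * y t| + |y (t + 1)| ≤ |θ (t - 1) * y (t - 1)| + |y t| := by
    intro t ht
    obtain ⟨n, rfl⟩ : ∃ n, t = n + 1 := ⟨t - 1, by omega⟩
    have hkn : k ≤ n := by omega
    have hn0 : (2 : ℝ) ≤ n := by exact_mod_cast hk.trans hkn
    have hyn := hyabs n hkn
    have hyn1 := hyabs (n + 1) (by omega)
    have hyn2 := hyabs (n + 1 + 1) (by omega)
    have hrn := hrw n (by omega)
    have hkey := inv_four_mul_sqrt_le_inv_sqrt_sub (hk.trans hkn)
    have hA : 0 < √(n : ℝ) := Real.sqrt_pos.2 (by linarith)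
    have hB : 0 < √((n : ℝ) + 1) := Real.sqrt_pos.2 (by linarith)
    have hBA : √(n : ℝ) ≤ √((n : ℝ) + 1) := Real.sqrt_le_sqrt (by linarith)
    have hcast : ((n + 1 + 1 : ℕ) : ℝ) = (n : ℝ) + 2 := by push_cast; ring
    rw [hcast] at hyn2
    rw [Nat.cast_add_one] at hyn1
    have hmono : |y (n + 1)| ≤ |y n| := by
      rw [hyn, hyn1]
      gcongr
    have hθn : |θ (n + 1)| ≤ |θ n| + |y n| * |y (n + 1)| / w ^ 2 := by
      rw [hθ]
      refine (abs_sub _ _).trans ?_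
      rw [abs_div, abs_mul, abs_of_pos (lt_of_lt_of_le (by positivity) hrn)]
      gcongr
    have hstep : |y n| * |y (n + 1)| / w ^ 2 * |y (n + 1)| ≤
        |y (n + 1)| - |y (n + 1 + 1)| := by
      rw [hyn, hyn1, hyn2]
      have h := mul_le_mul_of_nonneg_left hkey (half_pos hw).le
      calc _ = w / 2 * (1 / (4 * √(n : ℝ) * (√((n : ℝ) + 1) * √((n : ℝ) + 1)))) := by
            generalize √(n : ℝ) = A at *
            generalize √((n : ℝ) + 1) = B at *
            field_simp
            norm_num
        _ ≤ _ := h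
        _ = _ := by ring
    rw [Nat.add_sub_cancel, abs_mul, abs_mul]
    have h₁ := mul_le_mul_of_nonneg_right hθn (abs_nonneg (y (n + 1)))
    have h₂ := mul_le_mul_of_nonneg_left hmono (abs_nonneg (θ n))
    linarith
  refine ⟨hdec, fun t ht => ?_⟩
  have hWt : W t = y t - θ (t - 1) * y (t - 1) := by
    have h := hy (t - 1)
    rw [Nat.sub_add_cancel (by omega)] at h
    linarith
  have hbound : |θ (t - 1) * y (t - 1)| + |y t| ≤ |θ k * y k| + |y (k + 1)| := by
    clear hWt
    induction t, ht using Nat.le_induction with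
    | base => simp
    | succ n hn ih => exact (hdec n hn).trans ih
  refine ⟨by rw [hWt], ?_⟩
  rw [hWt]
  refine (abs_sub _ _).trans ?_
  linarith
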